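/- arXiv:2101.10974 — 5 statements merged into one kernel-verified Lean document; each statement's English description precedes it below -/
import Mathlib

section
/- Let V be a finite-dimensional real normed vector space and let χ₁, …, χ_N (N ≥ 1) be linear functionals on V such that for every nonzero ξ ∈ V there exists some i with χᵢ(ξ) > 0. Then the function F : V → ℝ defined by F(ξ) = Σ_{i=1}^N exp(χᵢ(ξ)) is strictly convex. -/
/-- if linear functionals `χ₁, …, χ_N` on a finite-dimensional real normed
space `V` satisfy that every nonzero `ξ` has some `χᵢ(ξ) > 0`, then
`F ξ = Σᵢ exp(χᵢ ξ)` is strictly convex. -/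
theorem sum_exp_weights_strictConvex (V : Type*) [NormedAddCommGroup V]
    [NormedSpace ℝ V] [FiniteDimensional ℝ V]
    (N : ℕ) (hN : 1 ≤ N) (χ : Fin N → V →ₗ[ℝ] ℝ)
    (hpos : ∀ ξ : V, ξ ≠ 0 → ∃ i, 0 < χ i ξ) :
    StrictConvexOn ℝ Set.univ fun ξ : V => ∑ i, Real.exp (χ i ξ) := by
  refine ⟨convex_univ, fun x _ y _ hxy a b ha hb hab => ?_⟩
  simp only [smul_eq_mul, Finset.mul_sum, ← Finset.sum_add_distrib, map_add, map_smul]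
  obtain ⟨i, hi⟩ := hpos (x - y) (sub_ne_zero.mpr hxy)
  rw [map_sub, sub_pos] at hi
  refine Finset.sum_lt_sum (fun j _ => ?_) ⟨i, Finset.mem_univ i, ?_⟩
  · exact convexOn_exp.2 (Set.mem_univ (χ j x)) (Set.mem_univ (χ j y)) ha.le hb.le hab
  · exact strictConvexOn_exp.2 (Set.mem_univ (χ i x)) (Set.mem_univ (χ i y)) hi.ne' ha hb hab
end

section
/- Let V be a finite-dimensional real normed vector space and let χ₁, …, χ_N (N ≥ 1) be linear functionals on V such that for every nonzero ξ ∈ V there exists some i with χᵢ(ξ) > 0. Then the function F : V → ℝ defined by F(ξ) = Σ_{i=1}^N exp(χᵢ(ξ)) is proper, i.e., F(ξ) → +∞ as ‖ξ‖ → +∞. -/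
/-- If every nonzero vector is positive for some functional in a finite family, then the sum of the
positive parts of the functionals dominates a positive multiple of the norm. -/
theorem exists_pos_mul_norm_le_sum_max_zero {V ι : Type*} [NormedAddCommGroup V]
    [NormedSpace ℝ V] [FiniteDimensional ℝ V] [Fintype ι] (χ : ι → V →ₗ[ℝ] ℝ)
    (hpos : ∀ ξ : V, ξ ≠ 0 → ∃ i, 0 < χ i ξ) :
    ∃ c : ℝ, 0 < c ∧ ∀ ξ : V, c * ‖ξ‖ ≤ ∑ i, max (χ i ξ) 0 := by
  have : ProperSpace V := FiniteDimensional.proper_real V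
  have hcont : Continuous fun ξ : V => ∑ i, max (χ i ξ) 0 :=
    continuous_finsetSum _ fun i _ =>
      (χ i).continuous_of_finiteDimensional.max continuous_const
  obtain ⟨c, hc, hle⟩ := (isCompact_sphere (0 : V) 1).exists_forall_le' hcont.continuousOn
    (a := 0) fun ξ hξ => by
      obtain ⟨i, hi⟩ := hpos ξ (ne_zero_of_mem_unit_sphere ⟨ξ, hξ⟩)
      exact Finset.sum_pos' (fun _ _ => le_max_right _ _)
        ⟨i, Finset.mem_univ i, lt_max_of_lt_left hi⟩
  refine ⟨c, hc, fun ξ => ?_⟩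
  rcases eq_or_ne ξ 0 with rfl | hξ
  · simp
  have hn : 0 < ‖ξ‖ := norm_pos_iff.2 hξ
  have h := hle (‖ξ‖⁻¹ • ξ) (by simp [norm_smul, hn.ne'])
  have hsum : ∑ i, max (χ i (‖ξ‖⁻¹ • ξ)) 0 = ‖ξ‖⁻¹ * ∑ i, max (χ i ξ) 0 := by
    rw [Finset.mul_sum]
    refine Finset.sum_congr rfl fun i _ => ?_
    rw [mul_max_of_nonneg _ _ (inv_nonneg.2 hn.le), map_smul, smul_eq_mul, mul_zero]
  rwa [hsum, inv_mul_eq_div, le_div_iff₀ hn] at h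


/-- if linear functionals `χ₁, …, χ_N` on a finite-dimensional real normed
space `V` satisfy that every nonzero `ξ` has some `χᵢ(ξ) > 0`, then
`F ξ = Σᵢ exp(χᵢ ξ)` is proper: `F ξ → +∞` as `‖ξ‖ → +∞`. -/
theorem sum_exp_weights_proper (V : Type*) [NormedAddCommGroup V]
    [NormedSpace ℝ V] [FiniteDimensional ℝ V]
    (N : ℕ) (hN : 1 ≤ N) (χ : Fin N → V →ₗ[ℝ] ℝ)
    (hpos : ∀ ξ : V, ξ ≠ 0 → ∃ i, 0 < χ i ξ) :
    Filter.Tendsto (fun ξ : V => ∑ i, Real.exp (χ i ξ))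
      (Filter.comap (fun ξ : V => ‖ξ‖) Filter.atTop) Filter.atTop := by
  obtain ⟨c, hc, hle⟩ := exists_pos_mul_norm_le_sum_max_zero χ hpos
  refine Filter.tendsto_atTop_mono (fun ξ => (hle ξ).trans ?_)
    (Filter.tendsto_comap.const_mul_atTop hc)
  exact Finset.sum_le_sum fun i _ =>
    max_le ((le_add_of_nonneg_right zero_le_one).trans (Real.add_one_le_exp _)) (Real.exp_pos _).le
end

section
/- Let V be a finite-dimensional real normed vector space and let χ₁, …, χ_N (N ≥ 1) be linear functionals on V such that for every nonzero ξ ∈ V there exists some i with χᵢ(ξ) > ized0. Then there exists a unique ξ₀ ∈ V such that Σ_{i=1}^N χᵢ(η)·exp(χᵢ(ξ₀)) = 0 for every η ∈ V, and ξ₀ is the unique global minimizer of the function F(ξ) = Σ_{i=1}^N exp(χᵢ(ξ)) on V. -/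
/-- A positively homogeneous continuous function, positive away from the origin, dominates a
positive multiple of the norm. -/
lemma exists_pos_mul_norm_le_of_posHomogeneous {V : Type*} [NormedAddCommGroup V]
    [NormedSpace ℝ V] [FiniteDimensional ℝ V] {g : V → ℝ} (hg : Continuous g)
    (hhom : ∀ r : ℝ, 0 ≤ r → ∀ ξ, g (r • ξ) = r * g ξ) (hpos : ∀ ξ, ξ ≠ 0 → 0 < g ξ) :
    ∃ c : ℝ, 0 < c ∧ ∀ ξ, c * ‖ξ‖ ≤ g ξ := by
  obtain ⟨c, hc, hle⟩ := (isCompact_sphere (0 : V) 1).exists_forall_le' hg.continuousOn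
    (fun ξ hξ ↦ hpos ξ (ne_zero_of_mem_unit_sphere ⟨ξ, hξ⟩))
  refine ⟨c, hc, fun ξ ↦ ?_⟩
  rcases eq_or_ne ξ 0 with rfl | hξ
  · simpa using (hhom 0 le_rfl 0).ge
  have hn : 0 < ‖ξ‖ := norm_pos_iff.2 hξ
  have h := hle (‖ξ‖⁻¹ • ξ) (by simp [norm_smul, hn.ne'])
  rw [hhom _ (inv_nonneg.2 hn.le), inv_mul_eq_div, le_div_iff₀ hn] at h
  exact h

section SumExp

variable {V ι : Type*} [Fintype ι]

open Filter in
lemma tendsto_sum_exp_cocompact_atTop [NormedAddCommGroup V] [NormedSpace ℝ V]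
    [FiniteDimensional ℝ V] (χ : ι → V →ₗ[ℝ] ℝ) (hpos : ∀ ξ : V, ξ ≠ 0 → ∃ i, 0 < χ i ξ) :
    Tendsto (fun ξ ↦ ∑ i, Real.exp (χ i ξ)) (cocompact V) atTop := by
  have hcont (i : ι) : Continuous (χ i) := (χ i).continuous_of_finiteDimensional
  obtain ⟨c, hc, hle⟩ := exists_pos_mul_norm_le_of_posHomogeneous
    (g := fun ξ ↦ ∑ i, max (χ i ξ) 0)
    (continuous_finsetSum _ fun i _ ↦ (hcont i).max continuous_const)
    (fun r hr ξ ↦ by simp [Finset.mul_sum, mul_max_of_nonneg _ _ hr])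
    (fun ξ hξ ↦ by
      obtain ⟨i, hi⟩ := hpos ξ hξ
      exact Finset.sum_pos' (fun _ _ ↦ le_max_right _ _)
        ⟨i, Finset.mem_univ i, lt_max_of_lt_left hi⟩)
  refine tendsto_atTop_mono (fun ξ ↦ (hle ξ).trans ?_)
    ((tendsto_norm_cocompact_atTop (E := V)).const_mul_atTop hc)
  refine Finset.sum_le_sum fun i _ ↦ max_le ?_ (Real.exp_pos _).le
  linarith [Real.add_one_le_exp (χ i ξ)]

lemma sum_mul_exp_eq_zero_of_forall_le [AddCommGroup V] [Module ℝ V] (χ : ι → V →ₗ[ℝ] ℝ)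
    {ξ₀ : V} (hmin : ∀ ξ, ∑ i, Real.exp (χ i ξ₀) ≤ ∑ i, Real.exp (χ i ξ)) (η : V) :
    ∑ i, χ i η * Real.exp (χ i ξ₀) = 0 := by
  have hderiv : HasDerivAt (fun t : ℝ ↦ ∑ i, Real.exp (χ i ξ₀ + t * χ i η))
      (∑ i, χ i η * Real.exp (χ i ξ₀)) 0 := by
    refine HasDerivAt.fun_sum fun i _ ↦ ?_
    simpa [mul_comm] using
      (((hasDerivAt_id (0 : ℝ)).mul_const (χ i η)).const_add (χ i ξ₀)).exp
  refine IsLocalMin.hasDerivAt_eq_zero (Filter.Eventually.of_forall fun t ↦ ?_) hderiv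
  simpa using hmin (ξ₀ + t • η)

lemma sum_exp_lt_sum_exp_of_sum_mul_exp_eq_zero [AddCommGroup V] [Module ℝ V]
    (χ : ι → V →ₗ[ℝ] ℝ) (hne : ∀ ξ : V, ξ ≠ 0 → ∃ i, χ i ξ ≠ 0) {ξ₀ ξ : V}
    (hcrit : ∀ η, ∑ i, χ i η * Real.exp (χ i ξ₀) = 0) (hξ : ξ ≠ ξ₀) :
    ∑ i, Real.exp (χ i ξ₀) < ∑ i, Real.exp (χ i ξ) := by
  have hexp (i : ι) : Real.exp (χ i ξ) = Real.exp (χ i (ξ - ξ₀)) * Real.exp (χ i ξ₀) := by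
    rw [← Real.exp_add, ← map_add, sub_add_cancel]
  obtain ⟨j, hj⟩ := hne (ξ - ξ₀) (sub_ne_zero.2 hξ)
  calc ∑ i, Real.exp (χ i ξ₀)
      = ∑ i, (χ i (ξ - ξ₀) + 1) * Real.exp (χ i ξ₀) := by
        simp only [add_mul, one_mul, Finset.sum_add_distrib, hcrit, zero_add]
    _ < ∑ i, Real.exp (χ i ξ) := by
        simp only [hexp]
        exact Finset.sum_lt_sum
          (fun i _ ↦ mul_le_mul_of_nonneg_right (Real.add_one_le_exp _) (Real.exp_pos _).le)
          ⟨j, Finset.mem_univ j,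
            mul_lt_mul_of_pos_right (Real.add_one_lt_exp hj) (Real.exp_pos _)⟩

end SumExp

/-- if linear functionals `χ₁, …, χ_N` on a finite-dimensional real normed
space `V` satisfy that every nonzero `ξ` has some `χᵢ(ξ) > 0`, then there is a unique
`ξ₀ ∈ V` with `Σᵢ χᵢ(η)·exp(χᵢ ξ₀) = 0` for all `η`, and `ξ₀` is the unique global
minimizer of `F ξ = Σᵢ exp(χᵢ ξ)`. -/
theorem sum_exp_weights_unique_critical_point (V : Type*) [NormedAddCommGroup V]
    [NormedSpace ℝ V] [FiniteDimensional ℝ V]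
    (N : ℕ) (hN : 1 ≤ N) (χ : Fin N → V →ₗ[ℝ] ℝ)
    (hpos : ∀ ξ : V, ξ ≠ 0 → ∃ i, 0 < χ i ξ) :
    ∃ ξ₀ : V,
      (∀ η : V, ∑ i, χ i η * Real.exp (χ i ξ₀) = 0) ∧
      (∀ ξ : V, ξ ≠ ξ₀ → ∑ i, Real.exp (χ i ξ₀) < ∑ i, Real.exp (χ i ξ)) ∧
      (∀ ξ₁ : V, (∀ η : V, ∑ i, χ i η * Real.exp (χ i ξ₁) = 0) → ξ₁ = ξ₀) := by
  have hcont : Continuous fun ξ ↦ ∑ i, Real.exp (χ i ξ) :=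
    continuous_finsetSum _ fun i _ ↦ ((χ i).continuous_of_finiteDimensional).rexp
  obtain ⟨ξ₀, hmin⟩ := hcont.exists_forall_le (tendsto_sum_exp_cocompact_atTop χ hpos)
  have hcrit := sum_mul_exp_eq_zero_of_forall_le χ hmin
  have hne (ξ : V) (hξ : ξ ≠ 0) : ∃ i, χ i ξ ≠ 0 := (hpos ξ hξ).imp fun _ h ↦ h.ne'
  refine ⟨ξ₀, hcrit, fun ξ hξ ↦ sum_exp_lt_sum_exp_of_sum_mul_exp_eq_zero χ hne hcrit hξ,
    fun ξ₁ h₁ ↦ by_contra fun h ↦ ?_⟩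
  exact (hmin ξ₁).not_gt
    (sum_exp_lt_sum_exp_of_sum_mul_exp_eq_zero χ hne h₁ (Ne.symm h))
end

section
/- Let E be a finite-dimensional real normed vector space and let f : E → ℝ be a convex function such that for every nonzero v ∈ E one has f(t·v) → +∞ as t → +∞. Then f is coercive: f(x) → +∞ as ‖x‖ → +∞. -/
/-- Slopes of a convex function along a ray from the origin are nondecreasing. -/
theorem ConvexOn.mul_sub_zero_le_smul_sub_zero {E : Type*} [AddCommGroup E] [Module ℝ E]
    {f : E → ℝ} (hconv : ConvexOn ℝ Set.univ f) (x : E) {s : ℝ} (hs : 1 ≤ s) :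
    s * (f x - f 0) ≤ f (s • x) - f 0 := by
  have hs0 : 0 < s := by linarith
  have h := hconv.2 (Set.mem_univ (s • x)) (Set.mem_univ 0) (inv_nonneg.2 hs0.le)
    (sub_nonneg.2 (inv_le_one_of_one_le₀ hs)) (add_sub_cancel _ _)
  rw [smul_zero, add_zero, inv_smul_smul₀ hs0.ne', smul_eq_mul, smul_eq_mul] at h
  calc s * (f x - f 0) ≤ s * (s⁻¹ * f (s • x) + (1 - s⁻¹) * f 0 - f 0) := by gcongr
    _ = f (s • x) - f 0 := by field_simp; ring

/-- A convex function diverging along every ray exceeds its value at the origin by more than one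
on some sphere centered at the origin. -/
theorem ConvexOn.exists_forall_mem_sphere_add_one_lt {E : Type*} [NormedAddCommGroup E]
    [NormedSpace ℝ E] [FiniteDimensional ℝ E] {f : E → ℝ} (hconv : ConvexOn ℝ Set.univ f)
    (hray : ∀ v : E, v ≠ 0 →
      Filter.Tendsto (fun t : ℝ => f (t • v)) Filter.atTop Filter.atTop) :
    ∃ r : ℝ, 0 < r ∧ ∀ v ∈ Metric.sphere (0 : E) 1, f 0 + 1 < f (r • v) := by
  have : ProperSpace E := FiniteDimensional.proper ℝ E
  have hcont : Continuous f :=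
    continuousOn_univ.1 (hconv.continuousOn isOpen_univ)
  let U : ℕ → Set E := fun n => {v | f 0 + 1 < f (((n : ℝ) + 1) • v)}
  have hmono : Monotone U := by
    intro m n hmn v (hv : f 0 + 1 < f (((m : ℝ) + 1) • v))
    have hm : (0 : ℝ) < m + 1 := by positivity
    have hs : (1 : ℝ) ≤ (n + 1) / (m + 1) := by
      rw [one_le_div hm]
      gcongr
    have h := hconv.mul_sub_zero_le_smul_sub_zero (((m : ℝ) + 1) • v) hs
    rw [smul_smul, div_mul_cancel₀ _ hm.ne'] at h
    change f 0 + 1 < f (((n : ℝ) + 1) • v)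
    nlinarith
  obtain ⟨n, hn⟩ := (isCompact_sphere (0 : E) 1).elim_directed_cover U
    (fun n => isOpen_lt continuous_const (hcont.comp (continuous_const_smul _)))
    (fun v hv => by
      obtain ⟨n, hn⟩ := (((hray v (ne_zero_of_mem_unit_sphere ⟨v, hv⟩)).comp
        (Filter.tendsto_atTop_add_const_right _ (1 : ℝ)
          tendsto_natCast_atTop_atTop)).eventually_gt_atTop (f 0 + 1)).exists
      exact Set.mem_iUnion.2 ⟨n, hn⟩)
    hmono.directed_le
  exact ⟨n + 1, by positivity, fun v hv => hn hv⟩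

/-- a convex function on a finite-dimensional real normed space that tends
to `+∞` along every ray `t ↦ t·v` (`v ≠ 0`, `t → +∞`) is coercive. -/
theorem convexOn_coercive_of_ray_divergence (E : Type*) [NormedAddCommGroup E]
    [NormedSpace ℝ E] [FiniteDimensional ℝ E]
    (f : E → ℝ) (hconv : ConvexOn ℝ Set.univ f)
    (hray : ∀ v : E, v ≠ 0 →
      Filter.Tendsto (fun t : ℝ => f (t • v)) Filter.atTop Filter.atTop) :
    Filter.Tendsto f (Filter.comap (fun x : E => ‖x‖) Filter.atTop) Filter.atTop := by
  obtain ⟨r, hr, hsphere⟩ := hconv.exists_forall_mem_sphere_add_one_lt hray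
  have hbound : ∀ x : E, r ≤ ‖x‖ → f 0 + ‖x‖ / r ≤ f x := by
    intro x hx
    have hx0 : 0 < ‖x‖ := hr.trans_le hx
    have hunit : ‖x‖⁻¹ • x ∈ Metric.sphere (0 : E) 1 := by
      rw [mem_sphere_zero_iff_norm, norm_smul, norm_inv, norm_norm, inv_mul_cancel₀ hx0.ne']
    have hs : 1 ≤ ‖x‖ / r := (one_le_div hr).2 hx
    have h := hconv.mul_sub_zero_le_smul_sub_zero (r • ‖x‖⁻¹ • x) hs
    rw [smul_smul (‖x‖ / r), div_mul_cancel₀ _ hr.ne', smul_inv_smul₀ hx0.ne'] at h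
    nlinarith [hsphere _ hunit]
  have hnorm : Filter.Tendsto (fun x : E => ‖x‖)
      (Filter.comap (fun x : E => ‖x‖) Filter.atTop) Filter.atTop := Filter.tendsto_comap
  refine Filter.tendsto_atTop_mono' _ ?_
    (Filter.tendsto_atTop_add_const_left _ (f 0) (hnorm.atTop_div_const hr))
  filter_upwards [hnorm.eventually_ge_atTop r] with x hx using hbound x hx
end

section
/- Let H be a finite-dimensional complex inner product space, let A be a self-adjoint linear endomorphism of H, let λ ∈ ℝ, ε ≥ 0, and let e₁, …, e_m be an orthonormal family in H such that ‖A·eⱼ − λ·eⱼ‖ ≤ ε for every j = 1, …, m. Then the sum of the dimensions of the eigenspaces of A corresponding to eigenvalues lying in the closed interval [λ − √m·ε, λ + √m·ε] is at least m. -/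
open Module.End in
/-- A vector orthogonal to all eigenspaces of a symmetric `A` whose eigenvalue lies within `r` of
`lam`, and on which `A - lam` is bounded by `r`, vanishes. -/
theorem LinearMap.IsSymmetric.eq_zero_of_norm_apply_sub_smul_le {H : Type*} [NormedAddCommGroup H]
    [InnerProductSpace ℂ H] [FiniteDimensional ℂ H] {A : H →ₗ[ℂ] H} (hA : A.IsSymmetric)
    {lam r : ℝ} (hr : 0 ≤ r) {v : H}
    (hv : v ∈ (⨆ μ ∈ Set.Icc (lam - r) (lam + r), eigenspace A (μ : ℂ))ᗮ)
    (hle : ‖A v - (lam : ℂ) • v‖ ≤ r * ‖v‖) : v = 0 := by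
  let b := hA.eigenvectorBasis rfl
  let ev := hA.eigenvalues rfl
  have hcoord (i) : inner ℂ (b i) (A v - (lam : ℂ) • v)
      = ((ev i - lam : ℝ) : ℂ) * inner ℂ (b i) v := by
    rw [inner_sub_right, inner_smul_right, ← hA, hA.apply_eigenvectorBasis, inner_smul_left]
    simp [b, ev, sub_mul]
  have hzero (i) (hi : |ev i - lam| ≤ r) : inner ℂ (b i) v = 0 := by
    refine Submodule.inner_right_of_mem_orthogonal (Submodule.mem_iSup_of_mem (ev i)
      (Submodule.mem_iSup_of_mem ?_ (hA.hasEigenvector_eigenvectorBasis rfl i).1)) hv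
    rw [abs_le] at hi
    constructor <;> linarith
  have hterm (i) : r ^ 2 * ‖inner ℂ (b i) v‖ ^ 2
      ≤ ‖inner ℂ (b i) (A v - (lam : ℂ) • v)‖ ^ 2 := by
    rw [hcoord, norm_mul, mul_pow, Complex.norm_real, Real.norm_eq_abs]
    rcases le_total |ev i - lam| r with h | h
    · simp [hzero i h]
    · gcongr
  have hsum : ∑ i, ‖inner ℂ (b i) (A v - (lam : ℂ) • v)‖ ^ 2
      ≤ ∑ i, r ^ 2 * ‖inner ℂ (b i) v‖ ^ 2 := by
    rw [← Finset.mul_sum, b.sum_sq_norm_inner_right, b.sum_sq_norm_inner_right, ← mul_pow]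
    gcongr
  have heq := (Finset.sum_eq_sum_iff_of_le fun i _ => hterm i).1
    (le_antisymm (Finset.sum_le_sum fun i _ => hterm i) hsum)
  refine InnerProductSpace.ext_inner_left_basis b.toBasis fun i => ?_
  rw [OrthonormalBasis.coe_toBasis, inner_zero_right]
  by_cases h : |ev i - lam| ≤ r
  · exact hzero i h
  · have h1 := heq i (Finset.mem_univ i)
    rw [hcoord, norm_mul, mul_pow, Complex.norm_real, Real.norm_eq_abs] at h1
    have h2 : r ^ 2 < |ev i - lam| ^ 2 := by
      have := not_le.1 h
      gcongr
    by_contra hne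
    have h3 : 0 < ‖inner ℂ (b i) v‖ ^ 2 := by positivity
    exact absurd h1 (mul_lt_mul_of_pos_right h2 h3).ne

/-- A linear map bounded by `ε` on an orthonormal family `e` of `m` vectors is bounded by `√m * ε`
on the span of `e`. -/
theorem Orthonormal.norm_map_sum_smul_le {H F : Type*} [NormedAddCommGroup H]
    [InnerProductSpace ℂ H] [SeminormedAddCommGroup F] [NormedSpace ℂ F] {ι : Type*} [Fintype ι]
    {e : ι → H} (he : Orthonormal ℂ e) (B : H →ₗ[ℂ] F) {ε : ℝ} (hε : 0 ≤ ε)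
    (hB : ∀ j, ‖B (e j)‖ ≤ ε) (c : ι → ℂ) :
    ‖B (∑ j, c j • e j)‖ ≤ √(Fintype.card ι) * ε * ‖∑ j, c j • e j‖ := by
  have hnorm : ‖∑ j, c j • e j‖ ^ 2 = ∑ j, ‖c j‖ ^ 2 := by
    have h := he.inner_sum c c Finset.univ
    rw [inner_self_eq_norm_sq_to_K] at h
    simp_rw [RCLike.conj_mul] at h
    exact_mod_cast h
  have hcs : ∑ j, ‖c j‖ ≤ √(Fintype.card ι) * ‖∑ j, c j • e j‖ := by
    refine le_of_sq_le_sq ?_ (by positivity)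
    rw [mul_pow, Real.sq_sqrt (Nat.cast_nonneg _), hnorm]
    exact sq_sum_le_card_mul_sum_sq
  calc ‖B (∑ j, c j • e j)‖ ≤ ∑ j, ‖c j‖ * ε := by
        rw [map_sum]
        refine norm_sum_le_of_le _ fun j _ => ?_
        rw [map_smul, norm_smul]
        gcongr
        exact hB j
    _ = (∑ j, ‖c j‖) * ε := (Finset.sum_mul ..).symm
    _ ≤ √(Fintype.card ι) * ‖∑ j, c j • e j‖ * ε := by gcongr
    _ = _ := by ring

/-- quasi-mode lemma: if `A` is a self-adjoint endomorphism of a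
finite-dimensional complex inner product space and `e₁, …, e_m` is an orthonormal family
with `‖A eⱼ − λ eⱼ‖ ≤ ε`, then the eigenspaces of `A` with eigenvalue in
`[λ − √m·ε, λ + √m·ε]` have total dimension at least `m`. -/
theorem quasi_mode_lemma (H : Type*) [NormedAddCommGroup H] [InnerProductSpace ℂ H]
    [FiniteDimensional ℂ H] (A : H →ₗ[ℂ] H) (hA : A.IsSymmetric)
    (lam ε : ℝ) (hε : 0 ≤ ε) (m : ℕ) (e : Fin m → H) (he : Orthonormal ℂ e)
    (happrox : ∀ j, ‖A (e j) - (lam : ℂ) • e j‖ ≤ ε) :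
    m ≤ Module.finrank ℂ
      ↥(⨆ μ ∈ Set.Icc (lam - Real.sqrt m * ε) (lam + Real.sqrt m * ε),
          Module.End.eigenspace A (μ : ℂ)) := by
  set S := ⨆ μ ∈ Set.Icc (lam - Real.sqrt m * ε) (lam + Real.sqrt m * ε),
    Module.End.eigenspace A (μ : ℂ)
  let f : (Fin m → ℂ) →ₗ[ℂ] S :=
    S.orthogonalProjectionOnto.toLinearMap ∘ₗ Fintype.linearCombination ℂ e
  have hf : Function.Injective f := by
    refine (injective_iff_map_eq_zero f).2 fun c hc => ?_
    have hv : ∑ j, c j • e j ∈ Sᗮ := Submodule.orthogonalProjectionOnto_eq_zero_iff.1 hc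
    have hle := he.norm_map_sum_smul_le (A - (lam : ℂ) • LinearMap.id) hε (by simpa using happrox) c
    rw [Fintype.card_fin] at hle
    exact funext <| Fintype.linearIndependent_iff.1 he.linearIndependent c
      (hA.eq_zero_of_norm_apply_sub_smul_le (by positivity) hv hle)
  simpa using LinearMap.finrank_le_finrank_of_injective hf
end
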